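/- arXiv:2102.01947 — 2 statements merged into one kernel-verified Lean document; each statement's English description precedes it below -/
import Mathlib

section
/- Let V be a finite-dimensional F_{q^2}-vector space with nondegenerate sesquilinear Hermitian form τ, X a τ-Hermitian nilpotent operator (τ(Xu,v) = τ(u,Xv)), and for k ≥ 2 set V_k := {x : X^{k-1}x ∈ range(X^k)}. For x, y ∈ V_k choose x' with X^k x' = X^{k-1} x; then τ_k(x, y) := τ(X^{k-2}x, y) − τ(X^{k-1}x', y) is well-defined (independent of the choice of x'), is a Hermitian sesquilinear form on V_k, and its radical equals V_{k-1}. -/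
/-- The subspace `V_k = {x ∈ V : X^(k-1) x ∈ range (X^k)}`. -/
def Vsub {K V : Type*} [Field K] [AddCommGroup V] [Module K V]
    (X : Module.End K V) (k : ℕ) : Submodule K V :=
  Submodule.comap (X ^ (k - 1)) (LinearMap.range (X ^ k))

theorem stmt9_surj {K V : Type*} [Field K] [Fintype K] [AddCommGroup V] [Module K V]
    [FiniteDimensional K V] (σ : K →+* K) (B : V → V → K)
    (hB1 : ∀ x y z, B (x + y) z = B x z + B y z)
    (hB2 : ∀ x y z, B x (y + z) = B x y + B x z)
    (hB3 : ∀ (a : K) (x y : V), B (a • x) y = a * B x y)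
    (hherm : ∀ x y, σ (B x y) = B y x)
    (hnd : ∀ x, (∀ y, B x y = 0) → x = 0) (f : Module.Dual K V) :
    ∃ y, ∀ x, B x y = f x := by
  classical
  let g : V → Module.Dual K V := fun y =>
    { toFun := fun x => B x y
      map_add' := fun a b => hB1 a b y
      map_smul' := fun a b => hB3 a b y }
  have hg : Function.Injective g := by
    intro y z hyz
    have h1 : ∀ x, B x y = B x z := fun x => LinearMap.congr_fun hyz x
    rw [← sub_eq_zero]
    apply hnd
    intro x
    have h2 : B x (y - z) = 0 := by
      have := hB2 x (y - z) z
      rw [sub_add_cancel, h1] at this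
      simpa using this
    rw [← hherm, h2, map_zero]
  have : Finite V := Module.finite_of_finite K
  let e := (Module.finBasis K V).toDualEquiv
  have hs : Function.Surjective (fun y => e.symm (g y)) :=
    Finite.surjective_of_injective (e.symm.injective.comp hg)
  obtain ⟨y, hy⟩ := hs (e.symm f)
  exact ⟨y, fun x => LinearMap.congr_fun (e.symm.injective hy) x⟩

/-- Let `K = F_{q²}` (q an odd prime power) with Frobenius involution `σ x = x^q`, `B` a
nondegenerate sesquilinear Hermitian form on the finite-dimensional space `V`, and `X` a
nilpotent `B`-Hermitian operator.  For `k ≥ 2` and `x, y ∈ V_k`, choosing `x'` with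
`X^k x' = X^(k-1) x`, the quantity `τ_k(x, y) = B(X^(k-2) x, y) − B(X^(k-1) x', y)` is
independent of the choice of `x'`, defines a Hermitian form on `V_k`, and its radical is
exactly `V_{k-1}`. -/
theorem stmt9 {K V : Type*} [Field K] [Fintype K] [AddCommGroup V] [Module K V]
    [FiniteDimensional K V]
    (p q : ℕ) (hp : p.Prime) (hpodd : Odd p) (hq : ∃ m : ℕ, 0 < m ∧ q = p ^ m)
    (hcard : Fintype.card K = q ^ 2)
    (σ : K →+* K) (hσ : ∀ x : K, σ x = x ^ q)
    (B : V → V → K)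
    (hB1 : ∀ x y z, B (x + y) z = B x z + B y z)
    (hB2 : ∀ x y z, B x (y + z) = B x y + B x z)
    (hB3 : ∀ (a : K) (x y : V), B (a • x) y = a * B x y)
    (hB4 : ∀ (a : K) (x y : V), B x (a • y) = σ a * B x y)
    (hherm : ∀ x y, σ (B x y) = B y x)
    (hnd : ∀ x, (∀ y, B x y = 0) → x = 0)
    (X : Module.End K V) (hXnil : IsNilpotent X)
    (hXherm : ∀ u v, B (X u) v = B u (X v))
    (k : ℕ) (hk : 2 ≤ k) :
    -- (i) independence of the choice of `x'`
    (∀ x y x₁ x₂ : V, x ∈ Vsub X k → y ∈ Vsub X k →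
      (X ^ k) x₁ = (X ^ (k - 1)) x → (X ^ k) x₂ = (X ^ (k - 1)) x →
      B ((X ^ (k - 1)) x₁) y = B ((X ^ (k - 1)) x₂) y) ∧
    -- (ii) `τ_k` is a Hermitian form on `V_k`
    (∀ x y x' y' : V, x ∈ Vsub X k → y ∈ Vsub X k →
      (X ^ k) x' = (X ^ (k - 1)) x → (X ^ k) y' = (X ^ (k - 1)) y →
      σ (B ((X ^ (k - 2)) x) y - B ((X ^ (k - 1)) x') y)
        = B ((X ^ (k - 2)) y) x - B ((X ^ (k - 1)) y') x) ∧
    -- (iii) the radical of `τ_k` equals `V_{k-1}`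
    (∀ x : V, x ∈ Vsub X k →
      (x ∈ Vsub X (k - 1) ↔ ∀ y x' : V, y ∈ Vsub X k →
        (X ^ k) x' = (X ^ (k - 1)) x →
        B ((X ^ (k - 2)) x) y - B ((X ^ (k - 1)) x') y = 0)) := by
  have hpow : ∀ (n : ℕ) (u v : V), B ((X ^ n) u) v = B u ((X ^ n) v) := by
    intro n
    induction n with
    | zero => intro u v; simp
    | succ n ih =>
      intro u v
      rw [pow_succ, Module.End.mul_apply, ih, hXherm, ← Module.End.mul_apply, ← pow_succ',
        ← pow_succ]
  have hneg : ∀ x y, B (-x) y = - B x y := by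
    intro x y
    have := hB3 (-1) x y
    simpa using this
  have hsub : ∀ x y z, B (x - y) z = B x z - B y z := by
    intro x y z
    rw [sub_eq_add_neg, hB1, hneg, sub_eq_add_neg]
  have hi : ∀ x y x₁ x₂ : V, y ∈ Vsub X k →
      (X ^ k) x₁ = (X ^ (k - 1)) x → (X ^ k) x₂ = (X ^ (k - 1)) x →
      B ((X ^ (k - 1)) x₁) y = B ((X ^ (k - 1)) x₂) y := by
    rintro x y x₁ x₂ ⟨y', hy'⟩ h1 h2
    rw [hpow, hpow _ x₂, ← hy', ← hpow, ← hpow, h1, h2]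
  obtain ⟨n, rfl⟩ : ∃ n, k = n + 2 := ⟨k - 2, by omega⟩
  refine ⟨fun x y x₁ x₂ _ hy => hi x y x₁ x₂ hy, ?_, ?_⟩
  · intro x y x' y' _ _ hx' hy'
    rw [map_sub, hherm, hherm, ← hpow, ← hpow, ← hy', hpow _ y', hx', ← hpow _ y']
  · intro x hx
    have e1 : n + 2 - 1 = n + 1 := by omega
    have e2 : n + 2 - 2 = n := by omega
    have e3 : n + 1 - 1 = n := by omega
    simp only [e1, e2] at hi ⊢
    constructor
    · rintro ⟨z, hz⟩ y x' hy hx'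
      rw [e3] at hz
      have hz2 : (X ^ (n + 2)) z = (X ^ (n + 1)) x := by
        rw [pow_succ', Module.End.mul_apply, hz, ← Module.End.mul_apply, ← pow_succ']
      rw [hi x y x' z hy hx' hz2, hz, sub_self]
    · intro h
      obtain ⟨x', hx'⟩ := hx
      rw [e1] at hx'
      have key : (X ^ n) x - (X ^ (n + 1)) x' ∈ LinearMap.range (X ^ (n + 1)) := by
        by_contra hw
        obtain ⟨f, hf, hf0⟩ := Submodule.exists_dual_map_eq_bot_of_notMem hw inferInstance
        obtain ⟨y, hy⟩ := stmt9_surj σ B hB1 hB2 hB3 hherm hnd f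
        apply hf
        have hker : (X ^ (n + 1)) y = 0 := by
          apply hnd
          intro z
          rw [← hherm, ← hpow, hy]
          have : f ((X ^ (n + 1)) z) ∈ (LinearMap.range (X ^ (n + 1))).map f :=
            Submodule.mem_map_of_mem ⟨z, rfl⟩
          rw [hf0, Submodule.mem_bot] at this
          rw [this, map_zero]
        rw [← hy, hsub]
        apply h y x' _ hx'
        refine ⟨0, ?_⟩
        rw [map_zero, e1, hker]
      obtain ⟨z, hz⟩ := key
      refine ⟨x' + z, ?_⟩
      rw [map_add, hz, e3]
      abel
end

section
/- Let E be an m-dimensional vector space over F_{q^2} with a nondegenerate sesquilinear Hermitian form κ (with respect to x ↦ x^q). Then the number of vectors x ∈ E with κ(x, x) = 0 equals q^{2m−1} + (−1)^m q^{m−1}(q − 1), and consequently the number of x with κ(x,x) ≠ 0 equals q^{2m} − q^{2m−1} − (−1)^m q^{m−1}(q−1). This count is independent of the choice of κ. -/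
theorem aux_prim {K : Type*} [Field K] [Fintype K] (q : ℕ) (hcard : Fintype.card K = q ^ 2) :
    ∃ ζ : K, IsPrimitiveRoot ζ (q ^ 2 - 1) ∧ ∀ x : K, x ≠ 0 → ∃ k : ℕ, ζ ^ k = x := by
  classical
  obtain ⟨g, hg⟩ := IsCyclic.exists_monoid_generator (α := Kˣ)
  refine ⟨(g : K), ?_, ?_⟩
  · rw [IsPrimitiveRoot.coe_units_iff]
    have h : orderOf g = q ^ 2 - 1 := by
      rw [orderOf_eq_card_of_forall_mem_zpowers, Nat.card_eq_fintype_card, Fintype.card_units, hcard]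
      intro x
      obtain ⟨k, hk⟩ := hg x
      exact ⟨k, by simpa using hk⟩
    rw [← h]
    exact IsPrimitiveRoot.orderOf g
  · intro x hx
    obtain ⟨k, hk⟩ := hg (Units.mk0 x hx)
    refine ⟨k, ?_⟩
    have := congrArg (fun u : Kˣ => (u : K)) hk
    simpa using this

theorem aux_norm {K : Type*} [Field K] [Fintype K] (q : ℕ) (hq : 2 ≤ q)
    (hcard : Fintype.card K = q ^ 2) (t : K) (ht : t ≠ 0) (htq : t ^ q = t) :
    Nat.card {a : K // a * a ^ q = t} = q + 1 := by
  classical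
  obtain ⟨ζ, hζ, hgen⟩ := aux_prim (K := K) q hcard
  have hfac : q ^ 2 - 1 = (q - 1) * (q + 1) := by
    obtain ⟨r, rfl⟩ : ∃ r, q = r + 1 := ⟨q - 1, by omega⟩
    have : (r + 1) ^ 2 = r * (r + 1 + 1) + 1 := by ring
    simp [this]
  have hpos : 0 < q ^ 2 - 1 := by rw [hfac]; exact Nat.mul_pos (by omega) (by omega)
  have hprim : IsPrimitiveRoot (ζ ^ (q - 1)) (q + 1) := hζ.pow hpos hfac
  have ht1 : t ^ (q - 1) = 1 := by
    apply mul_right_cancel₀ ht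
    rw [← pow_succ, one_mul, Nat.sub_add_cancel (by omega), htq]
  obtain ⟨k, rfl⟩ := hgen t ht
  have hdvd : q + 1 ∣ k := by
    rw [← pow_mul, hζ.pow_eq_one_iff_dvd, hfac, mul_comm k] at ht1
    exact Nat.dvd_of_mul_dvd_mul_left (by omega) ht1
  obtain ⟨j, rfl⟩ := hdvd
  have hc := hprim.card_nthRoots (ζ ^ ((q + 1) * j))
  rw [if_pos ⟨ζ ^ j, by rw [← pow_mul, mul_comm]⟩] at hc
  have hnd : (Polynomial.nthRoots (q + 1) (ζ ^ ((q + 1) * j))).Nodup := hprim.nthRoots_nodup ht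
  rw [← Multiset.toFinset_card_of_nodup hnd] at hc
  conv_rhs => rw [← hc]
  rw [Nat.card_eq_fintype_card, Fintype.card_subtype]
  congr 1
  ext a
  simp [Polynomial.mem_nthRoots, pow_succ']

theorem aux_trace {K : Type*} [Field K] [Fintype K] (q : ℕ) (hq : 2 ≤ q)
    (hcard : Fintype.card K = q ^ 2) : ∃ z : K, z + z ^ q ≠ 0 := by
  by_contra! h
  obtain ⟨ζ, hζ, -⟩ := aux_prim (K := K) q hcard
  have hz : ζ ^ q = - ζ := by linear_combination h ζ
  have h4 : 4 ≤ q ^ 2 := by nlinarith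
  have h0 : ζ ≠ 0 := hζ.ne_zero (by omega)
  have h1 : ζ ^ (q - 1) = -1 := by
    apply mul_right_cancel₀ h0
    rw [← pow_succ, Nat.sub_add_cancel (by omega), hz]; ring
  have h2 : ζ ^ ((q - 1) * 2) = 1 := by rw [pow_mul, h1]; ring
  rw [hζ.pow_eq_one_iff_dvd] at h2
  have h3 := Nat.le_of_dvd (by omega) h2
  have : q * q = q ^ 2 := by ring
  have : 2 * q ≤ q * q := Nat.mul_le_mul_right q hq
  omega

theorem aux_main {K : Type*} [Field K] [Fintype K] (q : ℕ) (hq : 2 ≤ q)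
    (hcard : Fintype.card K = q ^ 2)
    (σ : K →+* K) (hσ : ∀ x : K, σ x = x ^ q) (n : ℕ) :
    ∀ {E : Type*} [AddCommGroup E] [Module K E] [FiniteDimensional K E]
    (κ : E → E → K)
    (_ : ∀ x y z, κ (x + y) z = κ x z + κ y z)
    (_ : ∀ x y z, κ x (y + z) = κ x y + κ x z)
    (_ : ∀ (a : K) (x y : E), κ (a • x) y = a * κ x y)
    (_ : ∀ (a : K) (x y : E), κ x (a • y) = σ a * κ x y)
    (_ : ∀ x y, σ (κ x y) = κ y x)
    (_ : ∀ x, (∀ y, κ x y = 0) → x = 0)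
    (_ : Module.finrank K E = n),
    (Nat.card {x : E // κ x x = 0} : ℚ) * q
        = (q : ℚ) ^ (2 * n) + (-1) ^ n * (q : ℚ) ^ n * ((q : ℚ) - 1) := by
  classical
  induction n with
  | zero =>
    intro E _ _ _ κ h1 h2 h3 h4 hh hnd hn
    have : Subsingleton E := Module.finrank_zero_iff.mp hn
    have h0 : κ 0 0 = 0 := by have := h3 0 0 0; simpa using this
    have : Nat.card {x : E // κ x x = 0} = 1 := by
      rw [Nat.card_eq_one_iff_unique]
      exact ⟨inferInstance, ⟨⟨0, h0⟩⟩⟩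
    rw [this]; simp
  | succ n ih =>
    intro E _ _ _ κ h1 h2 h3 h4 hh hnd hn
    have : Nontrivial E := Module.nontrivial_of_finrank_pos (R := K) (by omega)
    have hv : ∃ v, κ v v ≠ 0 := by
      by_contra! hz
      obtain ⟨x, hx⟩ := exists_ne (0 : E)
      apply hx
      apply hnd
      intro y
      by_contra hb
      obtain ⟨z, hzz⟩ := aux_trace (K := K) q hq hcard
      apply hzz
      have e := hz ((z / κ x y) • x + y)
      rw [h1, h2, h2, hz, hz, h3, ← hh ((z / κ x y) • x) y, h3, div_mul_cancel₀ _ hb, hσ] at e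
      simpa using e
    obtain ⟨v, hv⟩ := hv
    let f : E →ₗ[K] K :=
      { toFun := fun x => κ x v
        map_add' := fun x y => h1 x y v
        map_smul' := fun a x => h3 a x v }
    have hf : ∀ x, f x = κ x v := fun _ => rfl
    have hsurj : Function.Surjective f := fun b => ⟨(b / κ v v) • v, by
      rw [hf, h3, div_mul_cancel₀ _ hv]⟩
    let W := LinearMap.ker f
    have hW : ∀ w : W, κ w v = 0 := fun w => w.2
    have hW' : ∀ w : W, κ v w = 0 := fun w => by rw [← hh, hW, map_zero]
    have hrank : Module.finrank K W = n := by
      have := LinearMap.finrank_range_add_finrank_ker f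
      rw [LinearMap.range_eq_top.mpr hsurj, finrank_top, Module.finrank_self, hn] at this
      change Module.finrank K (LinearMap.ker f) = n
      omega
    have hdec : ∀ x : E, x - (κ x v / κ v v) • v ∈ W := by
      intro x
      rw [LinearMap.mem_ker, map_sub, map_smul, hf, hf, smul_eq_mul, div_mul_cancel₀ _ hv, sub_self]
    have hIH := ih (E := W) (fun x y => κ x y) (fun x y z => h1 x y z) (fun x y z => h2 x y z)
      (fun a x y => h3 a x y) (fun a x y => h4 a x y) (fun x y => hh x y) (by
        intro w hw
        apply Subtype.ext
        apply hnd
        intro y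
        have e : y = (κ y v / κ v v) • v + (y - (κ y v / κ v v) • v) := by abel
        rw [e, h2, h4, hW, hw ⟨_, hdec y⟩]
        simp) hrank
    have hfinE : Finite E := Module.finite_of_finite K
    have : Fintype W := Fintype.ofFinite W
    have hexp : ∀ (a : K) (w : W), κ (a • v + w) (a • v + w) = a * a ^ q * κ v v + κ w w := by
      intro a w
      simp only [h1, h2, h3, h4, hW, hW', hσ]; ring
    let F : (Σ w : W, {a : K // a * a ^ q * κ v v + κ w w = 0}) → {x : E // κ x x = 0} :=
      fun p => ⟨p.2.1 • v + p.1, by rw [hexp]; exact p.2.2⟩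
    have hF : Function.Bijective F := by
      constructor
      · rintro ⟨w, a, ha⟩ ⟨w', a', ha'⟩ h
        have h' : a • v + (w : E) = a' • v + w' := congrArg Subtype.val h
        have haa : a = a' := by
          have e := congrArg f h'
          simp only [hf, h1, h3, hW, add_zero] at e
          exact mul_right_cancel₀ hv e
        subst haa
        have hww : w = w' := Subtype.ext (add_left_cancel h')
        subst hww
        rfl
      · rintro ⟨x, hx⟩
        have e : (κ x v / κ v v) • v + ((⟨_, hdec x⟩ : W) : E) = x := by simp
        refine ⟨⟨⟨_, hdec x⟩, ⟨κ x v / κ v v, ?_⟩⟩, Subtype.ext e⟩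
        rw [← hexp, e, hx]
    have hcardF : Nat.card {x : E // κ x x = 0} =
        ∑ w : W, Nat.card {a : K // a * a ^ q * κ v v + κ w w = 0} := by
      rw [← Nat.card_congr (Equiv.ofBijective F hF), Nat.card_sigma]
    have hfib : ∀ w : W, (Nat.card {a : K // a * a ^ q * κ v v + κ w w = 0} : ℚ) =
        (q + 1) - q * (if κ w w = 0 then 1 else 0) := by
      intro w
      have hiff : ∀ a : K, a * a ^ q * κ v v + κ w w = 0 ↔ a * a ^ q = - κ w w / κ v v := by
        intro a
        rw [eq_div_iff hv, eq_neg_iff_add_eq_zero]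
      simp only [hiff]
      split_ifs with h0
      · have : Nat.card {a : K // a * a ^ q = - κ w w / κ v v} = 1 := by
          rw [Nat.card_eq_one_iff_unique]
          refine ⟨⟨?_⟩, ⟨⟨0, by simp [h0]⟩⟩⟩
          have key : ∀ a : K, a * a ^ q = - κ w w / κ v v → a = 0 := by
            intro a ha
            rw [h0, neg_zero, zero_div, ← pow_succ'] at ha
            exact eq_zero_of_pow_eq_zero ha
          rintro ⟨a, ha⟩ ⟨b, hb⟩
          exact Subtype.ext ((key a ha).trans (key b hb).symm)
        rw [this]; push_cast; ring
      · rw [aux_norm q hq hcard]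
        · push_cast; ring
        · exact div_ne_zero (neg_ne_zero.mpr h0) hv
        · rw [← hσ, map_div₀, map_neg, hh, hh]
    have hWc : (Fintype.card W : ℚ) = (q : ℚ) ^ (2 * n) := by
      rw [Module.card_eq_pow_finrank (K := K) (V := W), hrank, hcard, ← pow_mul]; push_cast; rfl
    have hNW : (∑ w : W, (if κ w w = 0 then (1 : ℚ) else 0)) =
        (Nat.card {x : W // κ x x = 0} : ℚ) := by
      rw [Nat.card_eq_fintype_card, Fintype.card_subtype, Finset.sum_boole]
    rw [hcardF]
    push_cast
    simp only [hfib]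
    rw [Finset.sum_sub_distrib, ← Finset.mul_sum, hNW, Finset.sum_const, Finset.card_univ,
      nsmul_eq_mul, hWc]
    have : (q : ℚ) ^ (2 * (n + 1)) = (q : ℚ) ^ (2 * n) * q ^ 2 := by ring
    rw [this, pow_succ, pow_succ]
    linear_combination (-(q : ℚ)) * hIH

/-- Let `E` be an `m`-dimensional vector space over `K = F_{q²}` equipped with a nondegenerate
sesquilinear Hermitian form `κ` (with respect to the Frobenius involution `σ x = x^q`).  Then
`#{x ∈ E : κ(x,x) = 0} = q^(2m−1) + (−1)^m q^(m−1)(q−1)` and consequently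
`#{x ∈ E : κ(x,x) ≠ 0} = q^(2m) − q^(2m−1) − (−1)^m q^(m−1)(q−1)`; in particular, the counts
do not depend on the choice of `κ`. -/
theorem stmt10 {K E : Type*} [Field K] [Fintype K] [AddCommGroup E] [Module K E]
    [FiniteDimensional K E]
    (q : ℕ) (hq : IsPrimePow q) (hcard : Fintype.card K = q ^ 2)
    (σ : K →+* K) (hσ : ∀ x : K, σ x = x ^ q)
    (κ : E → E → K)
    (hκ1 : ∀ x y z, κ (x + y) z = κ x z + κ y z)
    (hκ2 : ∀ x y z, κ x (y + z) = κ x y + κ x z)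
    (hκ3 : ∀ (a : K) (x y : E), κ (a • x) y = a * κ x y)
    (hκ4 : ∀ (a : K) (x y : E), κ x (a • y) = σ a * κ x y)
    (hherm : ∀ x y, σ (κ x y) = κ y x)
    (hnd : ∀ x, (∀ y, κ x y = 0) → x = 0) :
    ((Nat.card {x : E // κ x x = 0} : ℚ)
        = (q : ℚ) ^ (2 * (Module.finrank K E : ℤ) - 1)
          + (-1) ^ (Module.finrank K E) * (q : ℚ) ^ ((Module.finrank K E : ℤ) - 1)
            * ((q : ℚ) - 1)) ∧
    ((Nat.card {x : E // κ x x ≠ 0} : ℚ)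
        = (q : ℚ) ^ (2 * (Module.finrank K E : ℤ))
          - (q : ℚ) ^ (2 * (Module.finrank K E : ℤ) - 1)
          - (-1) ^ (Module.finrank K E) * (q : ℚ) ^ ((Module.finrank K E : ℤ) - 1)
            * ((q : ℚ) - 1)) := by
  classical
  have hq2 : 2 ≤ q := hq.two_le
  have hm := aux_main q hq2 hcard σ hσ _ κ hκ1 hκ2 hκ3 hκ4 hherm hnd rfl
  have hfinE : Finite E := Module.finite_of_finite K
  have : Fintype E := Fintype.ofFinite E
  have hq0 : (q : ℚ) ≠ 0 := by exact_mod_cast (by omega : q ≠ 0)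
  have htot : (Nat.card {x : E // κ x x = 0} : ℚ) + Nat.card {x : E // κ x x ≠ 0}
      = (q : ℚ) ^ (2 * Module.finrank K E) := by
    have h1 : Nat.card {x : E // κ x x = 0} + Nat.card {x : E // κ x x ≠ 0}
        = Fintype.card E := by
      rw [← Nat.card_sum, ← Nat.card_eq_fintype_card]
      exact Nat.card_congr (Equiv.sumCompl (fun x : E => κ x x = 0))
    rw [Module.card_eq_pow_finrank (K := K) (V := E), hcard, ← pow_mul] at h1
    exact_mod_cast h1
  generalize Module.finrank K E = n at *
  have e1 : (q : ℚ) ^ (2 * (n : ℤ)) = (q : ℚ) ^ (2 * n) := by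
    exact_mod_cast zpow_natCast (q : ℚ) (2 * n)
  have hA : (Nat.card {x : E // κ x x = 0} : ℚ)
        = (q : ℚ) ^ (2 * (n : ℤ) - 1)
          + (-1) ^ n * (q : ℚ) ^ ((n : ℤ) - 1) * ((q : ℚ) - 1) := by
    rw [zpow_sub_one₀ hq0, zpow_sub_one₀ hq0, e1, zpow_natCast]
    field_simp
    linear_combination hm
  refine ⟨hA, ?_⟩
  rw [e1]
  linear_combination htot - hA
end
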